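/- Let K ≥ 2, a > 0, and α ∈ (0,1). Let S₁, …, S_K be i.i.d. Gamma(2,a)-distributed random variables and let S_{(1)} ≥ S_{(2)} ≥ … ≥ S_{(K)} be their values sorted in non-increasing order. Let B₂, …, B_K be i.i.d. Bernoulli(α²) random variables, and let Y be uniformly distributed on [1-α², 1], with (S₁,…,S_K), (B₂,…,B_K), and Y mutually independent. Let E be the event {∃ i ∈ {2,…,K} : B_i = 1} (so P(E) = 1 - λ with λ = (1-α²)^{K-1}), and on E let I = min{i ∈ {2,…,K} : B_i = 1}. Then E[log(1 + S_{(I)}·Y) | E] = (K·a²/((1-α²)·(1-λ)))·∫₀^∞ Υ^{ZF}(x)·x·e^{-a·x}·( [1 - α²·Γ(2, a·x)]^{K-1} - [γ(2, a·x)]^{K-1} ) dx. (This is the ergodic rate of the second user selected by the Max-Gain User Selection scheme with homogeneous users g₁ = … = g_K, using zero-forcing beamforming, with a = σ²/g.) -/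

import Mathlib

open MeasureTheory ProbabilityTheory Real Set
open scoped ENNReal ProbabilityTheory

/-- The Gamma(2, a) law: density `a² · x · e^{-a·x}` on `(0, ∞)` (shape 2, rate `a`). -/
noncomputable def gammaLaw (a : ℝ) : Measure ℝ :=
  volume.withDensity fun x =>
    ENNReal.ofReal (if 0 < x then a ^ 2 * x * Real.exp (-(a * x)) else 0)

/-- The uniform law on the real interval `[lo, hi]`. -/
noncomputable def unifLaw (lo hi : ℝ) : Measure ℝ :=
  (ENNReal.ofReal (hi - lo))⁻¹ • volume.restrict (Set.Icc lo hi)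

/-- The Bernoulli(p) law on `Bool`. -/
noncomputable def bernoulliLaw (p : ℝ) : Measure Bool :=
  ENNReal.ofReal p • Measure.dirac true + ENNReal.ofReal (1 - p) • Measure.dirac false

/-- The lower incomplete gamma function with shape 2: `γ(2, z) = 1 - (z+1)·e^{-z}`. -/
noncomputable def lGamma2 (z : ℝ) : ℝ := 1 - (z + 1) * Real.exp (-z)

/-- The upper incomplete gamma function with shape 2: `Γ(2, z) = (1+z)·e^{-z}`. -/
noncomputable def uGamma2 (z : ℝ) : ℝ := (1 + z) * Real.exp (-z)

/-- `Υ^{ZF}(x)` for orthogonality parameter `α`. -/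
noncomputable def UpsZF (α x : ℝ) : ℝ :=
  (1 / x) * ((1 + x) * Real.log (1 + x)
    - (1 + (1 - α ^ 2) * x) * Real.log (1 + (1 - α ^ 2) * x)) - α ^ 2

/-- The number of coordinates of `s` lying strictly below `x`. -/
noncomputable def countBelow {n : ℕ} (s : Fin n → ℝ) (x : ℝ) : ℕ :=
  ∑ j, if s j < x then 1 else 0

lemma measurable_countBelow {n : ℕ} :
    Measurable fun p : (Fin n → ℝ) × ℝ => countBelow p.1 p.2 := by
  unfold countBelow
  refine Finset.measurable_sum _ fun j _ => Measurable.ite ?_ measurable_const measurable_const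
  exact measurableSet_lt (by fun_prop) (by fun_prop)

lemma countBelow_le {n : ℕ} (s : Fin n → ℝ) (x : ℝ) : countBelow s x ≤ n := by
  unfold countBelow
  rw [← Finset.card_filter]
  exact (Finset.card_le_univ _).trans_eq (Fintype.card_fin n)

lemma countBelow_insertNth {n : ℕ} (k : Fin (n + 1)) (x : ℝ) (t : Fin n → ℝ) :
    countBelow (k.insertNth x t : Fin (n + 1) → ℝ) x = countBelow t x := by
  unfold countBelow
  rw [Fin.sum_univ_succAbove _ k]
  simp

lemma countBelow_sort {n : ℕ} {s : Fin n → ℝ} (hs : Function.Injective s) (i : Fin n) :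
    countBelow s (s (Tuple.sort s i)) = i := by
  have hmono : StrictMono (s ∘ Tuple.sort s) :=
    (Tuple.monotone_sort s).strictMono_of_injective (hs.comp (Tuple.sort s).injective)
  unfold countBelow
  rw [← Equiv.sum_comp (Tuple.sort s)]
  have h : ∀ j, (s (Tuple.sort s j) < s (Tuple.sort s i)) ↔ j < i := fun j => hmono.lt_iff_lt
  simp only [h]
  rw [← Finset.card_filter, Finset.filter_gt_eq_Iio]
  simp

lemma sum_countBelow_eq_sort {n : ℕ} {s : Fin n → ℝ} (hs : Function.Injective s) (i : Fin n)
    (g : ℝ → ℝ≥0∞) :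
    ∑ k, (if countBelow s (s k) = i then g (s k) else 0) = g (s (Tuple.sort s i)) := by
  rw [Finset.sum_eq_single (Tuple.sort s i)]
  · simp [countBelow_sort hs]
  · intro k _ hk
    refine if_neg fun h => hk ?_
    obtain ⟨j, rfl⟩ := (Tuple.sort s).surjective k
    rw [countBelow_sort hs] at h
    rw [Fin.ext h]
  · simp

lemma prod_ite_countBelow {n : ℕ} (t : Fin n → ℝ) (x : ℝ) (c : ℝ≥0∞) :
    ∏ j, (if t j < x then 1 else c) = c ^ (n - countBelow t x) := by
  unfold countBelow
  rw [Finset.prod_ite, Finset.prod_const_one, one_mul, Finset.prod_const, ← Finset.card_filter]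
  congr 1
  have := Finset.card_filter_add_card_filter_not (s := (Finset.univ : Finset (Fin n)))
    (fun j => t j < x)
  simp only [Finset.card_univ, Fintype.card_fin] at this
  omega

lemma lintegral_pi_insertNth {n : ℕ} (ν : Measure ℝ) [SigmaFinite ν] (k : Fin (n + 1))
    {f : (Fin (n + 1) → ℝ) → ℝ≥0∞} (hf : Measurable f) :
    ∫⁻ s, f s ∂(Measure.pi fun _ : Fin (n + 1) => ν)
      = ∫⁻ x, ∫⁻ t, f (k.insertNth x t : Fin (n + 1) → ℝ) ∂(Measure.pi fun _ : Fin n => ν) ∂ν := by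
  have h := (measurePreserving_piFinSuccAbove (fun _ : Fin (n + 1) => ν) k).symm
  rw [← h.lintegral_comp hf, lintegral_prod]
  · rfl
  · exact (hf.comp (MeasurableEquiv.measurable _)).aemeasurable

lemma lintegral_pi_prod_eq_pow (n : ℕ) (ν : Measure ℝ) [SigmaFinite ν] {g : ℝ → ℝ≥0∞}
    (hg : Measurable g) :
    ∫⁻ t, ∏ j, g (t j) ∂(Measure.pi fun _ : Fin n => ν) = (∫⁻ x, g x ∂ν) ^ n := by
  induction n with
  | zero => simp
  | succ n ih =>
    rw [lintegral_pi_insertNth ν 0 (by fun_prop)]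
    simp only [Fin.prod_univ_succAbove _ (0 : Fin (n + 1)), Fin.insertNth_apply_same,
      Fin.insertNth_apply_succAbove]
    have : ∀ x, ∫⁻ t, g x * ∏ j, g (t j) ∂(Measure.pi fun _ : Fin n => ν)
        = g x * (∫⁻ x, g x ∂ν) ^ n := fun x => by
      rw [lintegral_const_mul _ (by fun_prop), ih]
    simp only [this]
    rw [lintegral_mul_const _ hg, pow_succ']

lemma lintegral_ite_lt (ν : Measure ℝ) (x : ℝ) (A B : ℝ≥0∞) :
    ∫⁻ y, (if y < x then A else B) ∂ν = A * ν (Iio x) + B * ν (Ici x) := by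
  rw [← lintegral_add_compl _ (measurableSet_Iio : MeasurableSet (Iio x)), compl_Iio,
    setLIntegral_congr_fun (f := fun y => if y < x then A else B) (g := fun _ => A)
      measurableSet_Iio (fun y hy => if_pos hy),
    setLIntegral_congr_fun (f := fun y => if y < x then A else B) (g := fun _ => B)
      measurableSet_Ici (fun y hy => if_neg (not_lt.2 hy))]
  simp

/-- The probability that the rank selected by the Bernoulli marks has exactly `q` of the other
`m` values below it. -/
noncomputable def rankWeight (m : ℕ) (p c : ℝ≥0∞) (q : ℕ) : ℝ≥0∞ :=
  if q < m then p * c ^ (m - 1 - q) else 0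

lemma measurable_rankWeight_countBelow (m n : ℕ) (p c : ℝ≥0∞) :
    Measurable fun z : (Fin n → ℝ) × ℝ => rankWeight m p c (countBelow z.1 z.2) :=
  (measurable_from_top (f := rankWeight m p c)).comp measurable_countBelow

lemma lintegral_rankWeight (m : ℕ) (ν : Measure ℝ) [SigmaFinite ν] (p c : ℝ≥0∞) (x : ℝ) :
    c * ∫⁻ t, rankWeight m p c (countBelow t x) ∂(Measure.pi fun _ : Fin m => ν)
        + p * ν (Iio x) ^ m
      = p * (ν (Iio x) + c * ν (Ici x)) ^ m := by
  have hm : ∀ c : ℝ≥0∞, Measurable fun y : ℝ => if y < x then 1 else c := fun c =>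
    Measurable.ite measurableSet_Iio measurable_const measurable_const
  have h : ∀ c : ℝ≥0∞, ∫⁻ t, ∏ j, (if t j < x then 1 else c) ∂(Measure.pi fun _ : Fin m => ν)
      = (ν (Iio x) + c * ν (Ici x)) ^ m := fun c => by
    rw [lintegral_pi_prod_eq_pow m ν (hm c), lintegral_ite_lt, one_mul]
  have hp : ∀ c : ℝ≥0∞, Measurable fun t : Fin m → ℝ => ∏ j, (if t j < x then 1 else c) :=
    fun c => Finset.measurable_prod _ fun j _ => (hm c).comp (measurable_pi_apply j)
  have h0 := h 0
  rw [zero_mul, add_zero] at h0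
  have hw : Measurable fun t : Fin m → ℝ => rankWeight m p c (countBelow t x) :=
    (measurable_rankWeight_countBelow m m p c).comp (measurable_id.prodMk measurable_const)
  rw [← h c, ← h0, ← lintegral_const_mul _ (hp c), ← lintegral_const_mul _ (hp 0),
    ← lintegral_const_mul _ hw, ← lintegral_add_left (hw.const_mul c)]
  refine lintegral_congr fun t => ?_
  rw [prod_ite_countBelow, prod_ite_countBelow, rankWeight]
  rcases (countBelow_le t x).lt_or_eq with hlt | heq
  · rw [if_pos hlt, zero_pow (by omega), mul_zero, add_zero,
      show m - countBelow t x = m - 1 - countBelow t x + 1 by omega, pow_succ]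
    ring
  · simp [heq]

lemma lintegral_coord_mul_rankWeight (m : ℕ) (ν : Measure ℝ) [SigmaFinite ν] (p c : ℝ≥0∞)
    {ψ : ℝ → ℝ≥0∞} (hψ : Measurable ψ) (k : Fin (m + 1)) :
    ∫⁻ s, ψ (s k) * rankWeight m p c (countBelow s (s k)) ∂(Measure.pi fun _ : Fin (m + 1) => ν)
      = ∫⁻ x, ψ x * ∫⁻ t, rankWeight m p c (countBelow t x) ∂(Measure.pi fun _ : Fin m => ν) ∂ν := by
  rw [lintegral_pi_insertNth ν k]
  · refine lintegral_congr fun x => ?_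
    simp only [Fin.insertNth_apply_same, countBelow_insertNth]
    exact lintegral_const_mul _
      ((measurable_rankWeight_countBelow m m p c).comp (measurable_id.prodMk measurable_const))
  · exact (hψ.comp (measurable_pi_apply k)).mul
      ((measurable_rankWeight_countBelow m (m + 1) p c).comp
        (measurable_id.prodMk (measurable_pi_apply k)))

lemma ae_injective_pi (n : ℕ) (ν : Measure ℝ) [SigmaFinite ν] [NullSingletonClass ν] :
    ∀ᵐ s ∂(Measure.pi fun _ : Fin n => ν), Function.Injective s := by
  have h : ∀ i j : Fin n, i ≠ j → ∀ᵐ s ∂(Measure.pi fun _ : Fin n => ν), s i ≠ s j := by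
    intro i j hij
    obtain _ | n := n
    · exact i.elim0
    obtain ⟨j, rfl⟩ := Fin.exists_succAbove_eq hij.symm
    have hms : MeasurableSet {s : Fin (n + 1) → ℝ | s i = s (i.succAbove j)} :=
      measurableSet_eq_fun (by fun_prop) (by fun_prop)
    simp only [ae_iff, not_not]
    rw [← lintegral_indicator_one hms, lintegral_pi_insertNth ν i (measurable_one.indicator hms)]
    refine (lintegral_congr fun x => ?_).trans lintegral_zero
    rw [lintegral_congr_ae (g := 0), lintegral_zero_fun]
    filter_upwards [Measure.ae_eval_ne (μ := fun _ : Fin n => ν) j x] with t ht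
    simpa [Set.indicator_apply] using fun h => ht h.symm
  filter_upwards [ae_all_iff.2 fun i => ae_all_iff.2 fun j => ae_all_iff.2 (h i j)] with s hs i j hij
  by_contra hne
  exact hs i j hne hij

lemma gammaLaw_eq_gammaMeasure (a : ℝ) : gammaLaw a = gammaMeasure 2 a := by
  unfold gammaLaw gammaMeasure
  congr 1
  funext x
  rw [gammaPDF_eq]
  congr 1
  have h2 : (2 : ℝ) - 1 = 1 := by norm_num
  rcases lt_trichotomy x 0 with hx | rfl | hx
  · rw [if_neg hx.not_gt, if_neg hx.not_ge]
  · simp [h2]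
  · rw [if_pos hx, if_pos hx.le, h2, Real.rpow_one, Real.Gamma_two, div_one, Real.rpow_two]

lemma isProbabilityMeasure_gammaLaw {a : ℝ} (ha : 0 < a) : IsProbabilityMeasure (gammaLaw a) :=
  gammaLaw_eq_gammaMeasure a ▸ isProbabilityMeasure_gammaMeasure two_pos ha

instance nullSingletonClass_gammaLaw (a : ℝ) : NullSingletonClass (gammaLaw a) :=
  nullSingletonClass_withDensity _

lemma lintegral_gammaLaw (a : ℝ) {f : ℝ → ℝ≥0∞} (hf : Measurable f) :
    ∫⁻ x, f x ∂(gammaLaw a)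
      = ∫⁻ x in Ioi 0, ENNReal.ofReal (a ^ 2 * x * Real.exp (-(a * x))) * f x := by
  have hm : Measurable fun x : ℝ =>
      ENNReal.ofReal (if 0 < x then a ^ 2 * x * Real.exp (-(a * x)) else 0) :=
    (Measurable.ite measurableSet_Ioi (by fun_prop) measurable_const).ennreal_ofReal
  rw [gammaLaw, lintegral_withDensity_eq_lintegral_mul _ hm hf,
    ← lintegral_indicator measurableSet_Ioi]
  refine lintegral_congr fun x => ?_
  by_cases hx : 0 < x <;> simp [hx, Set.indicator]

lemma hasDerivAt_lGamma2_mul (a x : ℝ) :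
    HasDerivAt (fun x => lGamma2 (a * x)) (a ^ 2 * x * Real.exp (-(a * x))) x := by
  have h1 : HasDerivAt (fun x : ℝ => a * x) a x := by
    simpa using (hasDerivAt_id x).const_mul a
  have h := ((h1.add_const 1).mul h1.neg.exp).const_sub 1
  exact h.congr_deriv (by simp only [Pi.neg_apply]; ring)

lemma lGamma2_nonneg {z : ℝ} (hz : 0 ≤ z) : 0 ≤ lGamma2 z := by
  have h := Real.add_one_le_exp z
  have h2 : Real.exp z * Real.exp (-z) = 1 := by rw [← Real.exp_add]; simp
  unfold lGamma2
  nlinarith [Real.exp_pos (-z)]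

lemma lGamma2_add_uGamma2 (z : ℝ) : lGamma2 z + uGamma2 z = 1 := by
  unfold lGamma2 uGamma2; ring

lemma uGamma2_nonneg {z : ℝ} (hz : 0 ≤ z) : 0 ≤ uGamma2 z := by
  unfold uGamma2; positivity

lemma gammaLaw_Iio {a x : ℝ} (hx : 0 ≤ x) :
    gammaLaw a (Iio x) = ENNReal.ofReal (lGamma2 (a * x)) := by
  have hint : ∫ y in (0 : ℝ)..x, a ^ 2 * y * Real.exp (-(a * y)) = lGamma2 (a * x) := by
    rw [intervalIntegral.integral_eq_sub_of_hasDerivAt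
      (fun y _ => hasDerivAt_lGamma2_mul a y)
      (Continuous.intervalIntegrable (by fun_prop) _ _)]
    simp [lGamma2]
  rw [← lintegral_indicator_one measurableSet_Iio, lintegral_gammaLaw a
    (measurable_one.indicator measurableSet_Iio), ← hint, intervalIntegral.integral_of_le hx,
    integral_Ioc_eq_integral_Ioo, ofReal_integral_eq_lintegral_ofReal]
  · rw [← lintegral_indicator measurableSet_Ioi, ← lintegral_indicator measurableSet_Ioo]
    refine lintegral_congr fun y => ?_
    by_cases h0 : 0 < y <;> by_cases h1 : y < x <;> simp [h0, h1, Set.indicator]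
  · exact (Continuous.integrableOn_Icc (by fun_prop)).mono_set Ioo_subset_Icc_self
  · filter_upwards [ae_restrict_mem measurableSet_Ioo] with y hy
    have := hy.1
    positivity

lemma gammaLaw_Ici {a x : ℝ} (ha : 0 < a) (hx : 0 ≤ x) :
    gammaLaw a (Ici x) = ENNReal.ofReal (uGamma2 (a * x)) := by
  have := isProbabilityMeasure_gammaLaw ha
  rw [← compl_Iio, prob_compl_eq_one_sub measurableSet_Iio, gammaLaw_Iio hx,
    ← ENNReal.ofReal_one, ← ENNReal.ofReal_sub _ (lGamma2_nonneg (by positivity)),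
    ← lGamma2_add_uGamma2 (a * x), add_sub_cancel_left]

lemma ae_pos_gammaLaw (a : ℝ) : ∀ᵐ x ∂(gammaLaw a), 0 < x := by
  have h : {x : ℝ | ¬ 0 < x} =ᵐ[gammaLaw a] Iio 0 := by
    have : {x : ℝ | ¬ 0 < x} = Iic 0 := by ext; simp
    rw [this]
    exact Iio_ae_eq_Iic.symm
  rw [ae_iff, measure_congr h, gammaLaw_Iio le_rfl]
  simp [lGamma2]

lemma isProbabilityMeasure_unifLaw {lo hi : ℝ} (h : lo < hi) :
    IsProbabilityMeasure (unifLaw lo hi) := by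
  constructor
  simp only [unifLaw, Measure.smul_apply, Measure.restrict_apply_univ, Real.volume_Icc, smul_eq_mul]
  exact ENNReal.inv_mul_cancel (by simpa using h) ENNReal.ofReal_ne_top

lemma ae_mem_Icc_unifLaw (lo hi : ℝ) : ∀ᵐ y ∂(unifLaw lo hi), y ∈ Icc lo hi :=
  Measure.ae_smul_measure (ae_restrict_mem measurableSet_Icc) _

lemma hasDerivAt_log_primitive {x y : ℝ} (hx : x ≠ 0) (hxy : 0 < 1 + x * y) :
    HasDerivAt (fun y => ((1 + x * y) * Real.log (1 + x * y) - (1 + x * y)) / x)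
      (Real.log (1 + x * y)) y := by
  have h1 : HasDerivAt (fun y : ℝ => 1 + x * y) x y := by
    simpa using ((hasDerivAt_id y).const_mul x).const_add 1
  refine (((h1.mul (h1.log hxy.ne')).sub h1).div_const x).congr_deriv ?_
  field_simp
  ring

lemma integral_log_one_add_mul {α x : ℝ} (hα : α ∈ Ioo (0 : ℝ) 1) (hx : 0 < x) :
    ∫ y in Icc (1 - α ^ 2) 1, Real.log (1 + x * y) = UpsZF α x := by
  obtain ⟨h0, h1⟩ := hα
  have hle : 1 - α ^ 2 ≤ 1 := by nlinarith
  have hlo : 0 < 1 - α ^ 2 := by nlinarith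
  have hpos : ∀ y ∈ uIcc (1 - α ^ 2) 1, 0 < 1 + x * y := fun y hy => by
    rw [uIcc_of_le hle] at hy
    have : 0 < y := hlo.trans_le hy.1
    positivity
  rw [integral_Icc_eq_integral_Ioc, ← intervalIntegral.integral_of_le hle,
    intervalIntegral.integral_eq_sub_of_hasDerivAt
      (fun y hy => hasDerivAt_log_primitive hx.ne' (hpos y hy))
      (ContinuousOn.intervalIntegrable
        (ContinuousOn.log (by fun_prop) fun y hy => (hpos y hy).ne'))]
  unfold UpsZF
  field_simp
  ring

lemma UpsZF_nonneg {α x : ℝ} (hα : α ∈ Ioo (0 : ℝ) 1) (hx : 0 < x) : 0 ≤ UpsZF α x := by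
  rw [← integral_log_one_add_mul hα hx]
  refine setIntegral_nonneg measurableSet_Icc fun y hy => Real.log_nonneg ?_
  have : 0 ≤ y := le_trans (by nlinarith [hα.1, hα.2]) hy.1
  nlinarith [mul_nonneg hx.le this]

lemma lintegral_log_unifLaw {α x : ℝ} (hα : α ∈ Ioo (0 : ℝ) 1) (hx : 0 < x) :
    ∫⁻ y, ENNReal.ofReal (Real.log (1 + x * y)) ∂(unifLaw (1 - α ^ 2) 1)
      = (ENNReal.ofReal (α ^ 2))⁻¹ * ENNReal.ofReal (UpsZF α x) := by
  have hlo : 0 < 1 - α ^ 2 := by nlinarith [hα.1, hα.2]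
  have hpos : ∀ y ∈ Icc (1 - α ^ 2) 1, 0 ≤ x * y := fun y hy =>
    mul_nonneg hx.le (hlo.le.trans hy.1)
  rw [unifLaw, lintegral_smul_measure, sub_sub_cancel, smul_eq_mul,
    ← integral_log_one_add_mul hα hx, ofReal_integral_eq_lintegral_ofReal]
  · refine ContinuousOn.integrableOn_compact isCompact_Icc
      (ContinuousOn.log (by fun_prop) fun y hy => ?_)
    have := hpos y hy
    positivity
  · filter_upwards [ae_restrict_mem measurableSet_Icc] with y hy
    exact Real.log_nonneg (by linarith [hpos y hy])

lemma isProbabilityMeasure_bernoulliLaw {p : ℝ} (h0 : 0 ≤ p) (h1 : p ≤ 1) :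
    IsProbabilityMeasure (bernoulliLaw p) := by
  constructor
  simp [bernoulliLaw, ← ENNReal.ofReal_add h0 (sub_nonneg.2 h1)]

lemma bernoulliLaw_true (p : ℝ) : bernoulliLaw p {true} = ENNReal.ofReal p := by
  simp [bernoulliLaw]

lemma bernoulliLaw_false (p : ℝ) : bernoulliLaw p {false} = ENNReal.ofReal (1 - p) := by
  simp [bernoulliLaw]

/-- The marks whose first `true` is at position `n`. -/
def firstTrueAt (m n : ℕ) : Set (Fin m → Bool) :=
  {b | (∃ h : n < m, b ⟨n, h⟩ = true) ∧ ∀ i : Fin m, (i : ℕ) < n → b i = false}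

lemma pi_bernoulliLaw_firstTrueAt {m n : ℕ} (hn : n < m) {p : ℝ} (h0 : 0 ≤ p) (h1 : p ≤ 1) :
    (Measure.pi fun _ : Fin m => bernoulliLaw p) (firstTrueAt m n)
      = ENNReal.ofReal p * ENNReal.ofReal (1 - p) ^ n := by
  have := isProbabilityMeasure_bernoulliLaw h0 h1
  have hset : firstTrueAt m n = Set.pi univ fun i : Fin m =>
      if (i : ℕ) < n then {false} else if (i : ℕ) = n then {true} else univ := by
    ext b
    simp only [firstTrueAt, mem_ofPred_eq, Set.mem_pi, mem_univ, true_imp_iff]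
    constructor
    · rintro ⟨⟨h, hb⟩, hf⟩ i
      split_ifs with hi hi'
      · exact hf i hi
      · subst hi'; exact hb
      · trivial
    · intro h
      refine ⟨⟨hn, by simpa using h ⟨n, hn⟩⟩, fun i hi => by simpa [hi] using h i⟩
  rw [hset, Measure.pi_pi]
  have hval : ∀ i : Fin m, bernoulliLaw p
      (if (i : ℕ) < n then {false} else if (i : ℕ) = n then {true} else univ)
      = (if (i : ℕ) < n then ENNReal.ofReal (1 - p) else 1)
        * (if i = ⟨n, hn⟩ then ENNReal.ofReal p else 1) := by
    intro i
    rcases lt_trichotomy (i : ℕ) n with h | h | h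
    · simp [h, h.ne, Fin.ext_iff, bernoulliLaw_false]
    · simp [h, Fin.ext_iff, bernoulliLaw_true]
    · rw [if_neg h.not_gt, if_neg h.ne', measure_univ]
      simp [h.not_gt, h.ne', Fin.ext_iff]
  simp only [hval]
  rw [Finset.prod_mul_distrib, Finset.prod_ite_eq' Finset.univ, if_pos (Finset.mem_univ _), mul_comm,
    Finset.prod_ite, Finset.prod_const, Finset.prod_const_one, mul_one]
  congr 2
  have : (Finset.univ.filter fun i : Fin m => (i : ℕ) < n) = Finset.Iio ⟨n, hn⟩ := by
    ext i; simp [Fin.lt_def]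
  rw [this, Fin.card_Iio]

lemma pi_bernoulliLaw_exists_true (m : ℕ) {p : ℝ} (h0 : 0 ≤ p) (h1 : p ≤ 1) :
    (Measure.pi fun _ : Fin m => bernoulliLaw p) {b | ∃ i, b i = true}
      = ENNReal.ofReal (1 - (1 - p) ^ m) := by
  have := isProbabilityMeasure_bernoulliLaw h0 h1
  have hset : {b : Fin m → Bool | ∃ i, b i = true} = {fun _ => false}ᶜ := by
    ext b; simp [funext_iff]
  rw [hset, prob_compl_eq_one_sub (measurableSet_singleton _), Measure.pi_singleton]
  simp only [bernoulliLaw_false, Finset.prod_const, Finset.card_univ, Fintype.card_fin]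
  rw [← ENNReal.ofReal_pow (by linarith), ENNReal.ofReal_sub _ (by positivity [sub_nonneg.2 h1]),
    ENNReal.ofReal_one]
/-- The indicator that the marks `b` select the rank having `q` of the other `m` values
below it. -/
noncomputable def selects (m : ℕ) (b : Fin m → Bool) (q : ℕ) : ℝ≥0∞ :=
  if q < m then (firstTrueAt m (m - 1 - q)).indicator 1 b else 0

lemma measurable_selects_countBelow (m n : ℕ) (k : Fin n) :
    Measurable fun z : (Fin n → ℝ) × (Fin m → Bool) => selects m z.2 (countBelow z.1 (z.1 k)) := by
  have h : Measurable fun w : (Fin m → Bool) × ℕ => selects m w.1 w.2 := Measurable.of_discrete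
  exact h.comp (measurable_snd.prodMk (measurable_countBelow.comp
    (measurable_fst.prodMk ((measurable_pi_apply k).comp measurable_fst))))

lemma lintegral_selects (m q : ℕ) {p : ℝ} (h0 : 0 ≤ p) (h1 : p ≤ 1) :
    ∫⁻ b, selects m b q ∂(Measure.pi fun _ : Fin m => bernoulliLaw p)
      = rankWeight m (ENNReal.ofReal p) (ENNReal.ofReal (1 - p)) q := by
  unfold selects rankWeight
  split_ifs with hq
  · rw [lintegral_indicator_one (Set.toFinite _).measurableSet,
      pi_bernoulliLaw_firstTrueAt (by omega) h0 h1]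
  · simp

lemma selects_eq_zero {m : ℕ} {b : Fin m → Bool} (hb : ¬ ∃ i, b i = true) (q : ℕ) :
    selects m b q = 0 := by
  unfold selects
  split_ifs
  · exact Set.indicator_of_notMem (fun h => hb ⟨_, h.1.2⟩) _
  · rfl

lemma selects_eq_ite {m : ℕ} {b : Fin m → Bool} (hb : ∃ i, b i = true) (q : ℕ) :
    selects m b q = if q = m - 1 - sInf {n : ℕ | ∃ h : n < m, b ⟨n, h⟩ = true} then 1 else 0 := by
  set A := {n : ℕ | ∃ h : n < m, b ⟨n, h⟩ = true} with hA
  obtain ⟨i, hi⟩ := hb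
  obtain ⟨hN, hbN⟩ : sInf A ∈ A := Nat.sInf_mem ⟨i, i.2, hi⟩
  have hmem : ∀ n, b ∈ firstTrueAt m n ↔ n = sInf A := by
    intro n
    constructor
    · rintro ⟨⟨h, hb⟩, hf⟩
      refine le_antisymm ?_ (Nat.sInf_le ⟨h, hb⟩)
      by_contra! hlt
      simpa [hbN] using hf ⟨_, hN⟩ hlt
    · rintro rfl
      refine ⟨⟨hN, hbN⟩, fun j hj => ?_⟩
      by_contra hne
      exact Nat.notMem_of_lt_sInf hj ⟨j.2, by simpa using hne⟩
  unfold selects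
  simp only [Set.indicator, hmem, Pi.one_apply]
  split_ifs <;> first | rfl | omega

/-- The rate of the user selected by the marks `b`, given the received powers `s` and the
uniform variable `y`. -/
noncomputable def selectedRate (m : ℕ) (z : (Fin (m + 1) → ℝ) × (Fin m → Bool) × ℝ) : ℝ≥0∞ :=
  ∑ k, selects m z.2.1 (countBelow z.1 (z.1 k)) * ENNReal.ofReal (Real.log (1 + z.1 k * z.2.2))

lemma measurable_selectedRate_term (m : ℕ) (k : Fin (m + 1)) :
    Measurable fun z : (Fin (m + 1) → ℝ) × (Fin m → Bool) × ℝ =>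
      selects m z.2.1 (countBelow z.1 (z.1 k))
        * ENNReal.ofReal (Real.log (1 + z.1 k * z.2.2)) := by
  refine Measurable.mul ((measurable_selects_countBelow m (m + 1) k).comp
    (measurable_fst.prodMk (measurable_fst.comp measurable_snd))) ?_
  fun_prop

lemma measurable_selectedRate (m : ℕ) : Measurable (selectedRate m) :=
  Finset.measurable_sum _ fun k _ => measurable_selectedRate_term m k

lemma selectedRate_eq_sort {m : ℕ} {s : Fin (m + 1) → ℝ} (hs : Function.Injective s)
    {b : Fin m → Bool} (hb : ∃ i, b i = true) (y : ℝ) {j : Fin (m + 1)}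
    (hj : (j : ℕ) = m - 1 - sInf {n : ℕ | ∃ h : n < m, b ⟨n, h⟩ = true}) :
    selectedRate m (s, b, y) = ENNReal.ofReal (Real.log (1 + s (Tuple.sort s j) * y)) := by
  rw [← sum_countBelow_eq_sort hs j fun x => ENNReal.ofReal (Real.log (1 + x * y))]
  refine Finset.sum_congr rfl fun k _ => ?_
  simp only [selects_eq_ite hb, ← hj, ite_mul, one_mul, zero_mul]

lemma selectedRate_eq_zero {m : ℕ} (s : Fin (m + 1) → ℝ) {b : Fin m → Bool}
    (hb : ¬ ∃ i, b i = true) (y : ℝ) : selectedRate m (s, b, y) = 0 := by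
  simp [selectedRate, selects_eq_zero hb]

lemma lintegral_selectedRate (m : ℕ) (ν υ : Measure ℝ) [SigmaFinite ν] [SFinite υ]
    {p : ℝ} (h0 : 0 ≤ p) (h1 : p ≤ 1) :
    ∫⁻ z, selectedRate m z ∂((Measure.pi fun _ : Fin (m + 1) => ν).prod
        ((Measure.pi fun _ : Fin m => bernoulliLaw p).prod υ))
      = (m + 1 : ℕ) * ∫⁻ x, (∫⁻ y, ENNReal.ofReal (Real.log (1 + x * y)) ∂υ)
          * ∫⁻ t, rankWeight m (ENNReal.ofReal p) (ENNReal.ofReal (1 - p)) (countBelow t x)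
            ∂(Measure.pi fun _ : Fin m => ν) ∂ν := by
  have := isProbabilityMeasure_bernoulliLaw h0 h1
  have hψ : Measurable fun x : ℝ => ∫⁻ y, ENNReal.ofReal (Real.log (1 + x * y)) ∂υ :=
    Measurable.lintegral_prod_right' (f := fun z : ℝ × ℝ => ENNReal.ofReal (Real.log (1 + z.1 * z.2)))
      (by fun_prop)
  unfold selectedRate
  rw [lintegral_finsetSum _ fun k _ => measurable_selectedRate_term m k]
  have hk : ∀ k : Fin (m + 1),
      ∫⁻ z, selects m z.2.1 (countBelow z.1 (z.1 k))
          * ENNReal.ofReal (Real.log (1 + z.1 k * z.2.2))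
        ∂((Measure.pi fun _ : Fin (m + 1) => ν).prod
          ((Measure.pi fun _ : Fin m => bernoulliLaw p).prod υ))
      = ∫⁻ x, (∫⁻ y, ENNReal.ofReal (Real.log (1 + x * y)) ∂υ)
          * ∫⁻ t, rankWeight m (ENNReal.ofReal p) (ENNReal.ofReal (1 - p)) (countBelow t x)
            ∂(Measure.pi fun _ : Fin m => ν) ∂ν := by
    intro k
    rw [lintegral_prod _ (measurable_selectedRate_term m k).aemeasurable,
      ← lintegral_coord_mul_rankWeight m ν _ _ hψ k]
    refine lintegral_congr fun s => ?_
    rw [lintegral_prod_mul (f := fun b => selects m b (countBelow s (s k)))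
      Measurable.of_discrete.aemeasurable
      (by fun_prop : AEMeasurable (fun y => ENNReal.ofReal (Real.log (1 + s k * y))) υ),
      lintegral_selects m _ h0 h1, mul_comm]
  simp only [hk]
  simp

lemma lGamma2_le_one_sub {α z : ℝ} (hα : α ∈ Ioo (0 : ℝ) 1) (hz : 0 ≤ z) :
    lGamma2 z ≤ 1 - α ^ 2 * uGamma2 z := by
  have h1 : α ^ 2 ≤ 1 := by nlinarith [hα.1, hα.2]
  nlinarith [lGamma2_add_uGamma2 z, uGamma2_nonneg hz]

lemma lintegral_rankWeight_gammaLaw (m : ℕ) {a α x : ℝ} (ha : 0 < a) (hα : α ∈ Ioo (0 : ℝ) 1)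
    (hx : 0 ≤ x) :
    ∫⁻ t, rankWeight m (ENNReal.ofReal (α ^ 2)) (ENNReal.ofReal (1 - α ^ 2)) (countBelow t x)
        ∂(Measure.pi fun _ : Fin m => gammaLaw a)
      = ENNReal.ofReal (α ^ 2 / (1 - α ^ 2)
          * ((1 - α ^ 2 * uGamma2 (a * x)) ^ m - lGamma2 (a * x) ^ m)) := by
  have := isProbabilityMeasure_gammaLaw ha
  have hc : 0 < 1 - α ^ 2 := by nlinarith [hα.1, hα.2]
  have hax : 0 ≤ a * x := by positivity
  have hL := lGamma2_nonneg hax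
  have hU := uGamma2_nonneg hax
  have hle := lGamma2_le_one_sub hα hax
  have hsum := lGamma2_add_uGamma2 (a * x)
  have h := lintegral_rankWeight m (gammaLaw a) (ENNReal.ofReal (α ^ 2))
    (ENNReal.ofReal (1 - α ^ 2)) x
  have hpow : lGamma2 (a * x) ^ m ≤ (1 - α ^ 2 * uGamma2 (a * x)) ^ m :=
    pow_le_pow_left₀ hL hle m
  have hnn : 0 ≤ α ^ 2 / (1 - α ^ 2)
      * ((1 - α ^ 2 * uGamma2 (a * x)) ^ m - lGamma2 (a * x) ^ m) :=
    mul_nonneg (by positivity) (sub_nonneg.2 hpow)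
  have h' : ENNReal.ofReal (1 - α ^ 2) * ENNReal.ofReal (α ^ 2 / (1 - α ^ 2)
          * ((1 - α ^ 2 * uGamma2 (a * x)) ^ m - lGamma2 (a * x) ^ m))
        + ENNReal.ofReal (α ^ 2) * gammaLaw a (Iio x) ^ m
      = ENNReal.ofReal (α ^ 2)
        * (gammaLaw a (Iio x) + ENNReal.ofReal (1 - α ^ 2) * gammaLaw a (Ici x)) ^ m := by
    rw [gammaLaw_Iio hx, gammaLaw_Ici ha hx, ← ENNReal.ofReal_mul hc.le, ← ENNReal.ofReal_mul hc.le,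
      ← ENNReal.ofReal_add hL (by positivity), ← ENNReal.ofReal_pow hL,
      ← ENNReal.ofReal_pow (by positivity), ← ENNReal.ofReal_mul (by positivity),
      ← ENNReal.ofReal_mul (by positivity), ← ENNReal.ofReal_add (by positivity) (by positivity)]
    congr 1
    rw [show lGamma2 (a * x) + (1 - α ^ 2) * uGamma2 (a * x) = 1 - α ^ 2 * uGamma2 (a * x) by
      linear_combination hsum]
    field_simp
    ring
  rw [← h'] at h
  have hfin : ENNReal.ofReal (α ^ 2) * gammaLaw a (Iio x) ^ m ≠ ⊤ := by finiteness
  exact (ENNReal.mul_right_inj (by simpa using hc) ENNReal.ofReal_ne_top).1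
    ((ENNReal.add_left_inj hfin).1 h)

lemma lintegral_selectedRate_gammaLaw (m : ℕ) {a α : ℝ} (ha : 0 < a) (hα : α ∈ Ioo (0 : ℝ) 1) :
    ∫⁻ z, selectedRate m z ∂((Measure.pi fun _ : Fin (m + 1) => gammaLaw a).prod
        ((Measure.pi fun _ : Fin m => bernoulliLaw (α ^ 2)).prod (unifLaw (1 - α ^ 2) 1)))
      = (m + 1 : ℕ) * (ENNReal.ofReal (a ^ 2 / (1 - α ^ 2)) * ∫⁻ x in Ioi (0 : ℝ),
          ENNReal.ofReal (UpsZF α x * x * Real.exp (-(a * x)) *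
            ((1 - α ^ 2 * uGamma2 (a * x)) ^ m - (lGamma2 (a * x)) ^ m))) := by
  have hα2 : 0 < α ^ 2 := pow_pos hα.1 2
  have hc : 0 < 1 - α ^ 2 := by nlinarith [hα.1, hα.2]
  have := isProbabilityMeasure_gammaLaw ha
  have := isProbabilityMeasure_unifLaw (show 1 - α ^ 2 < 1 by linarith)
  rw [lintegral_selectedRate m _ _ hα2.le (by linarith), lintegral_gammaLaw,
    ← lintegral_const_mul' _ _ ENNReal.ofReal_ne_top]
  · congr 1
    refine setLIntegral_congr_fun measurableSet_Ioi fun x (hx : 0 < x) => ?_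
    have hU := UpsZF_nonneg hα hx
    have hax : 0 ≤ a * x := by positivity
    have hd : 0 ≤ (1 - α ^ 2 * uGamma2 (a * x)) ^ m - lGamma2 (a * x) ^ m :=
      sub_nonneg.2 (pow_le_pow_left₀ (lGamma2_nonneg hax) (lGamma2_le_one_sub hα hax) m)
    rw [lintegral_log_unifLaw hα hx, lintegral_rankWeight_gammaLaw m ha hα hx.le,
      ← ENNReal.ofReal_inv_of_pos hα2, ← ENNReal.ofReal_mul (by positivity),
      ← ENNReal.ofReal_mul (by positivity), ← ENNReal.ofReal_mul (by positivity),
      ← ENNReal.ofReal_mul (by positivity)]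
    congr 1
    have hα0 := hα.1.ne'
    field_simp
  · refine Measurable.mul ?_ ?_
    · exact Measurable.lintegral_prod_right'
        (f := fun z : ℝ × ℝ => ENNReal.ofReal (Real.log (1 + z.1 * z.2))) (by fun_prop)
    · exact Measurable.lintegral_prod_left' (measurable_rankWeight_countBelow m m _ _)

lemma measurable_UpsZF (α : ℝ) : Measurable (UpsZF α) := by
  unfold UpsZF
  fun_prop

lemma continuous_lGamma2 : Continuous lGamma2 := by unfold lGamma2; fun_prop

lemma continuous_uGamma2 : Continuous uGamma2 := by unfold uGamma2; fun_prop

lemma integral_rate_eq_toReal_lintegral (m : ℕ) {a α : ℝ} (ha : 0 < a) (hα : α ∈ Ioo (0 : ℝ) 1) :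
    ∫ x in Ioi (0 : ℝ), UpsZF α x * x * Real.exp (-(a * x)) *
        ((1 - α ^ 2 * uGamma2 (a * x)) ^ m - (lGamma2 (a * x)) ^ m)
      = (∫⁻ x in Ioi (0 : ℝ), ENNReal.ofReal (UpsZF α x * x * Real.exp (-(a * x)) *
          ((1 - α ^ 2 * uGamma2 (a * x)) ^ m - (lGamma2 (a * x)) ^ m))).toReal := by
  refine integral_eq_lintegral_of_nonneg_ae ?_ (Measurable.aestronglyMeasurable ?_)
  · filter_upwards [ae_restrict_mem measurableSet_Ioi] with x (hx : 0 < x)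
    have hax : 0 ≤ a * x := by positivity
    have hU := UpsZF_nonneg hα hx
    have hd : 0 ≤ (1 - α ^ 2 * uGamma2 (a * x)) ^ m - lGamma2 (a * x) ^ m :=
      sub_nonneg.2 (pow_le_pow_left₀ (lGamma2_nonneg hax) (lGamma2_le_one_sub hα hax) m)
    positivity
  · have h1 := measurable_UpsZF α
    have h2 := continuous_lGamma2.measurable
    have h3 := continuous_uGamma2.measurable
    fun_prop

lemma integral_cond_log_sort_eq {Ω : Type*} [MeasurableSpace Ω]
    (μ : Measure Ω) [IsProbabilityMeasure μ]
    (m : ℕ) (a α : ℝ) (ha : 0 < a) (hα : α ∈ Set.Ioo (0 : ℝ) 1)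
    (S : Fin (m + 1) → Ω → ℝ) (B : Fin m → Ω → Bool) (Y : Ω → ℝ)
    (hS : ∀ k, Measurable (S k)) (hB : ∀ i, Measurable (B i)) (hY : Measurable Y)
    (hlaw : Measure.map
        (fun ω => ((fun k => S k ω, fun i => B i ω, Y ω) :
          (Fin (m + 1) → ℝ) × (Fin m → Bool) × ℝ)) μ
      = (Measure.pi fun _ : Fin (m + 1) => gammaLaw a).prod
          ((Measure.pi fun _ : Fin m => bernoulliLaw (α ^ 2)).prod (unifLaw (1 - α ^ 2) 1)))
    (J : Ω → Fin (m + 1))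
    (hJ : ∀ ω, (J ω : ℕ) = m - 1 - sInf {n : ℕ | ∃ h : n < m, B ⟨n, h⟩ ω = true}) :
    ∫ ω, Real.log (1 + S (Tuple.sort (fun k => S k ω) (J ω)) ω * Y ω)
      ∂(μ[|{ω | ∃ i, B i ω = true}])
    = (((m + 1 : ℕ) : ℝ) * a ^ 2 / ((1 - α ^ 2) * (1 - (1 - α ^ 2) ^ m))) *
        ∫ x in Set.Ioi (0 : ℝ),
          UpsZF α x * x * Real.exp (-(a * x)) *
            ((1 - α ^ 2 * uGamma2 (a * x)) ^ m - (lGamma2 (a * x)) ^ m) := by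
  have hα2 : 0 < α ^ 2 := pow_pos hα.1 2
  have hc : 0 < 1 - α ^ 2 := by nlinarith [hα.1, hα.2]
  have := isProbabilityMeasure_gammaLaw ha
  have := isProbabilityMeasure_unifLaw (show 1 - α ^ 2 < 1 by linarith)
  have := isProbabilityMeasure_bernoulliLaw hα2.le (by linarith)
  set T : Ω → (Fin (m + 1) → ℝ) × (Fin m → Bool) × ℝ :=
    fun ω => (fun k => S k ω, fun i => B i ω, Y ω) with hTdef
  have hT : Measurable T := by fun_prop
  set E : Set Ω := {ω | ∃ i, B i ω = true} with hE
  have hEpre : E = T ⁻¹' (univ ×ˢ ({b | ∃ i, b i = true} ×ˢ univ)) := by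
    ext ω; simp [hE, hTdef]
  have hmE' : MeasurableSet (univ ×ˢ ({b | ∃ i, b i = true} ×ˢ univ) :
      Set ((Fin (m + 1) → ℝ) × (Fin m → Bool) × ℝ)) :=
    MeasurableSet.univ.prod ((Set.toFinite _).measurableSet.prod MeasurableSet.univ)
  have hmE : MeasurableSet E := hEpre ▸ hT hmE'
  have hμE : μ E = ENNReal.ofReal (1 - (1 - α ^ 2) ^ m) := by
    rw [hEpre, ← Measure.map_apply hT hmE', hlaw, Measure.prod_prod, Measure.prod_prod,
      measure_univ, measure_univ, one_mul, mul_one,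
      pi_bernoulliLaw_exists_true m hα2.le (by linarith)]
  have hpow : (1 - α ^ 2) ^ m ≤ 1 := pow_le_one₀ hc.le (by linarith)
  have hae : ∀ᵐ z ∂(Measure.map T μ), Function.Injective z.1 ∧ (∀ k, 0 < z.1 k) ∧ 0 < z.2.2 := by
    rw [hlaw]
    have h1 : ∀ᵐ s ∂(Measure.pi fun _ : Fin (m + 1) => gammaLaw a), ∀ k, 0 < s k :=
      ae_all_iff.2 fun k => Measure.tendsto_eval_ae_ae.eventually (ae_pos_gammaLaw a)
    filter_upwards [Measure.quasiMeasurePreserving_fst.ae (ae_injective_pi (m + 1) (gammaLaw a)),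
      Measure.quasiMeasurePreserving_fst.ae h1,
      Measure.quasiMeasurePreserving_snd.ae (Measure.quasiMeasurePreserving_snd.ae
        (ae_mem_Icc_unifLaw (1 - α ^ 2) 1))] with z hz1 hz2 hz3
    exact ⟨hz1, hz2, hc.trans_le hz3.1⟩
  have hrate : ∀ᵐ ω ∂(μ.restrict E), selectedRate m (T ω)
      = ENNReal.ofReal (Real.log (1 + S (Tuple.sort (fun k => S k ω) (J ω)) ω * Y ω)) := by
    filter_upwards [ae_restrict_of_ae (ae_of_ae_map hT.aemeasurable hae),
      ae_restrict_mem hmE] with ω hω hωE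
    exact selectedRate_eq_sort hω.1 hωE (Y ω) (hJ ω)
  have hsupp : (fun ω => selectedRate m (T ω)).support ⊆ E := fun ω hω => by
    by_contra hωE
    exact hω (selectedRate_eq_zero _ hωE _)
  have hint : ∫ ω in E, Real.log (1 + S (Tuple.sort (fun k => S k ω) (J ω)) ω * Y ω) ∂μ
      = (∫⁻ z, selectedRate m z ∂(Measure.map T μ)).toReal := by
    rw [lintegral_map (measurable_selectedRate m) hT, ← setLIntegral_eq_of_support_subset hsupp,
      ← integral_toReal]
    · refine integral_congr_ae ?_
      filter_upwards [ae_restrict_of_ae (ae_of_ae_map hT.aemeasurable hae), hrate] with ω hω hr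
      have h1 := hω.2.1 (Tuple.sort (fun k => S k ω) (J ω))
      have h2 := mul_pos h1 hω.2.2
      rw [hr, ENNReal.toReal_ofReal (Real.log_nonneg (le_add_of_nonneg_right h2.le))]
    · exact ((measurable_selectedRate m).comp hT).aemeasurable
    · filter_upwards [hrate] with ω hr
      rw [hr]
      exact ENNReal.ofReal_lt_top
  rw [ProbabilityTheory.cond, integral_smul_measure, hint, hlaw,
    lintegral_selectedRate_gammaLaw m ha hα, integral_rate_eq_toReal_lintegral m ha hα, hμE,
    ENNReal.toReal_inv, ENNReal.toReal_ofReal (by linarith), ENNReal.toReal_mul,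
    ENNReal.toReal_mul, ENNReal.toReal_ofReal (by positivity), ENNReal.toReal_natCast, smul_eq_mul]
  simp only [div_eq_mul_inv, mul_inv]
  ring

/-- Ergodic rate of the second user selected by the MUS scheme with
homogeneous users and zero-forcing beamforming. `S₁, …, S_K` are i.i.d. `Gamma(2, a)`;
`B` (indexed by `Fin (K-1)`, where index `n` stands for rank `n+2 ∈ {2, …, K}`) are
i.i.d. `Bernoulli(α²)`; `Y ~ Uniform[1-α², 1]`; all mutually independent (joint law the
product of the marginals). On the event `E = {∃ i, B_i = 1}`, the second scheduled user
has rank `I = (least n with B_n = 1) + 2`, so its SNR is the `I`-th largest value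
`S_{(I)}`, i.e. the value at position `K - I = K - 2 - (least n)` of the tuple sorted in
non-decreasing order. Then `E[log(1 + S_{(I)}·Y) | E]` equals
`(K·a²/((1-α²)(1-λ)))·∫₀^∞ Υ^{ZF}(x)·x·e^{-ax}·([1-α²Γ(2,ax)]^{K-1} - [γ(2,ax)]^{K-1}) dx`
with `λ = (1-α²)^{K-1}`. -/
theorem mus_second_user_zf_homogeneous_rate {Ω : Type*} [MeasurableSpace Ω]
    (μ : Measure Ω) [IsProbabilityMeasure μ]
    (K : ℕ) (hK : 2 ≤ K) (a α : ℝ) (ha : 0 < a) (hα : α ∈ Set.Ioo (0 : ℝ) 1)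
    (S : Fin K → Ω → ℝ) (B : Fin (K - 1) → Ω → Bool) (Y : Ω → ℝ)
    (hSmeas : ∀ k, Measurable (S k)) (hBmeas : ∀ i, Measurable (B i))
    (hYmeas : Measurable Y)
    (hlaw : Measure.map
        (fun ω => ((fun k => S k ω, fun i => B i ω, Y ω) :
          (Fin K → ℝ) × (Fin (K - 1) → Bool) × ℝ)) μ
      = (Measure.pi fun _ : Fin K => gammaLaw a).prod
          ((Measure.pi fun _ : Fin (K - 1) => bernoulliLaw (α ^ 2)).prod
            (unifLaw (1 - α ^ 2) 1))) :
    ∫ ω, Real.log (1 +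
        (fun k => S k ω) (Tuple.sort (fun k => S k ω)
          ⟨K - 2 - sInf {n : ℕ | ∃ h : n < K - 1, B ⟨n, h⟩ ω = true}, by omega⟩) * Y ω)
      ∂(μ[|{ω | ∃ i, B i ω = true}])
    = ((K : ℝ) * a ^ 2 / ((1 - α ^ 2) * (1 - (1 - α ^ 2) ^ (K - 1)))) *
        ∫ x in Set.Ioi (0 : ℝ),
          UpsZF α x * x * Real.exp (-(a * x)) *
            ((1 - α ^ 2 * uGamma2 (a * x)) ^ (K - 1) - (lGamma2 (a * x)) ^ (K - 1)) := by
  obtain ⟨m, rfl⟩ : ∃ m, K = m + 1 := ⟨K - 1, by omega⟩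
  exact integral_cond_log_sort_eq μ m a α ha hα S B Y hSmeas hBmeas hYmeas hlaw
    (fun ω => ⟨m + 1 - 2 - sInf {n : ℕ | ∃ h : n < m + 1 - 1, B ⟨n, h⟩ ω = true}, by omega⟩)
    fun ω => rfl
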